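/- arXiv:2507.20035 — 2 statements merged into one kernel-verified Lean document; each statement's English description precedes it below -/
import Mathlib

section
/- Let F : ℝ → ℝ be continuous and strictly monotonically increasing on a closed bounded interval S = [a,b] with F(a) = 0 and F(b) = 1. Then for every ε > 0 there exist K ∈ ℕ, weights w_1,…,w_K > 0 with Σ_{k=1}^K w_k = 1, points x_1,…,x_K ∈ ℝ, and bandwidths h_1,…,h_K > 0 such that for all x ∈ [a,b], |Σ_{k=1}^K w_k · σ((x − x_k)/h_k) − F(x)| < ε. -/
/-- The logistic sigmoid function `σ(t) = 1 / (1 + exp (−t))`. -/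
noncomputable def sigmoid (t : ℝ) : ℝ := 1 / (1 + Real.exp (-t))

lemma sigmoid_eq_real_sigmoid : sigmoid = Real.sigmoid := by
  funext t
  rw [sigmoid, Real.sigmoid_def, one_div]

/-- If the values `g k ≥ 0` are at least `1 - η` whenever `k / n < v`, then their average is at
least `v - η`. -/
lemma sub_le_average {n : ℕ} (hn : 0 < n) {g : ℕ → ℝ} {v η : ℝ} (hv : v ≤ 1) (hη : 0 ≤ η)
    (hg : ∀ k < n, 0 ≤ g k) (hg' : ∀ k < n, (k : ℝ) / n < v → 1 - η ≤ g k) :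
    v - η ≤ ∑ k ∈ Finset.range n, 1 / (n : ℝ) * g k := by
  have hn' : (0 : ℝ) < n := by exact_mod_cast hn
  have htel := Finset.sum_range_sub (fun k : ℕ ↦ min v ((k : ℝ) / n)) n
  have hterm : ∀ k ∈ Finset.range n,
      min v (((k + 1 : ℕ) : ℝ) / n) - min v ((k : ℝ) / n) - 1 / n * η ≤ 1 / (n : ℝ) * g k := by
    intro k hk
    rw [Finset.mem_range] at hk
    have hstep : ((k + 1 : ℕ) : ℝ) / n = k / n + 1 / n := by push_cast; ring
    have hpos : 0 < 1 / (n : ℝ) := by positivity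
    rcases lt_or_ge ((k : ℝ) / n) v with h | h
    · have h1 := mul_le_mul_of_nonneg_left (hg' k hk h) hpos.le
      have h2 := min_le_right v (((k + 1 : ℕ) : ℝ) / n)
      rw [min_eq_right h.le]
      linarith
    · have h1 := mul_nonneg hpos.le (hg k hk)
      have h2 := mul_nonneg hpos.le hη
      have h3 := min_le_left v (((k + 1 : ℕ) : ℝ) / n)
      rw [min_eq_left h]
      linarith
  have hsum := Finset.sum_le_sum hterm
  rw [Finset.sum_sub_distrib, htel, Finset.sum_const, Finset.card_range, nsmul_eq_mul,
    div_self hn'.ne', min_eq_left hv, ← mul_assoc, mul_one_div_cancel hn'.ne', one_mul] at hsum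
  have h0 : min v (((0 : ℕ) : ℝ) / n) ≤ 0 := (min_le_right _ _).trans (by simp)
  linarith

/-- If the values `g k ≤ 1` are at most `η` whenever `v ≤ k / n`, then their average is at
most `v + 1 / n + η`. -/
lemma average_le_add {n : ℕ} (hn : 0 < n) {g : ℕ → ℝ} {v η : ℝ} (hv : 0 ≤ v) (hη : 0 ≤ η)
    (hg : ∀ k < n, g k ≤ 1) (hg' : ∀ k < n, v ≤ (k : ℝ) / n → g k ≤ η) :
    ∑ k ∈ Finset.range n, 1 / (n : ℝ) * g k ≤ v + 1 / n + η := by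
  have hn' : (0 : ℝ) < n := by exact_mod_cast hn
  have hpos : 0 < 1 / (n : ℝ) := by positivity
  have htel := Finset.sum_range_sub (fun k : ℕ ↦ min (v + 1 / n) ((k : ℝ) / n)) n
  have hterm : ∀ k ∈ Finset.range n, 1 / (n : ℝ) * g k ≤
      min (v + 1 / n) (((k + 1 : ℕ) : ℝ) / n) - min (v + 1 / n) ((k : ℝ) / n) + 1 / n * η := by
    intro k hk
    rw [Finset.mem_range] at hk
    have hstep : ((k + 1 : ℕ) : ℝ) / n = k / n + 1 / n := by push_cast; ring
    rcases lt_or_ge ((k : ℝ) / n) v with h | h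
    · have h1 := mul_le_mul_of_nonneg_left (hg k hk) hpos.le
      have h2 := mul_nonneg hpos.le hη
      rw [hstep, min_eq_right (by linarith), min_eq_right (by linarith)]
      linarith
    · have h1 := mul_le_mul_of_nonneg_left (hg' k hk h) hpos.le
      have h2 : min (v + 1 / n) ((k : ℝ) / n) ≤ min (v + 1 / n) (((k + 1 : ℕ) : ℝ) / n) :=
        min_le_min_left _ (by linarith)
      linarith
  have hsum := Finset.sum_le_sum hterm
  rw [Finset.sum_add_distrib, htel, Finset.sum_const, Finset.card_range, nsmul_eq_mul,
    ← mul_assoc, mul_one_div_cancel hn'.ne', one_mul, Nat.cast_zero, zero_div,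
    min_eq_right (show (0 : ℝ) ≤ v + 1 / n by linarith)] at hsum
  have h1 := min_le_left (v + 1 / (n : ℝ)) ((n : ℝ) / n)
  linarith

/-- Any continuous, strictly monotone cdf on a closed bounded interval `[a, b]`
(with `F a = 0` and `F b = 1`) can be uniformly approximated on `[a, b]`
by a sigmoid kernel mixture. -/
theorem sigmoid_mixture_uniform_approximation
    (F : ℝ → ℝ) (a b : ℝ) (hab : a ≤ b)
    (hF_cont : ContinuousOn F (Set.Icc a b))
    (hF_mono : StrictMonoOn F (Set.Icc a b))
    (hFa : F a = 0) (hFb : F b = 1) :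
    ∀ ε > 0, ∃ (K : ℕ) (w x h : Fin K → ℝ),
      (∀ k, 0 < w k) ∧ (∑ k, w k = 1) ∧ (∀ k, 0 < h k) ∧
      ∀ y ∈ Set.Icc a b,
        |(∑ k, w k * sigmoid ((y - x k) / h k)) - F y| < ε := by
  intro ε hε
  obtain ⟨δ, hδ, hFδ⟩ := Metric.uniformContinuousOn_iff.mp
    (isCompact_Icc.uniformContinuousOn_of_continuous hF_cont) (ε / 4) (by linarith)
  obtain ⟨T, hT, hT0⟩ := ((Real.tendsto_sigmoid_atTop.eventually_const_lt
    (show 1 - ε / 4 < 1 by linarith)).and (Filter.eventually_gt_atTop 0)).exists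
  obtain ⟨m, hm⟩ := exists_nat_one_div_lt (show 0 < ε / 4 by linarith)
  obtain ⟨n, hn, hnε⟩ : ∃ n : ℕ, 0 < n ∧ 1 / (n : ℝ) < ε / 4 :=
    ⟨m + 1, m.succ_pos, by exact_mod_cast hm⟩
  have hn' : (0 : ℝ) < n := by exact_mod_cast hn
  have hquantile : ∀ k : ℕ, ∃ z, k < n → z ∈ Set.Icc a b ∧ F z = k / n := by
    intro k
    by_cases hk : k < n
    · have hmem : (k : ℝ) / n ∈ Set.Icc (F a) (F b) := by
        rw [hFa, hFb]
        exact ⟨by positivity, (div_le_one hn').mpr (by exact_mod_cast hk.le)⟩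
      obtain ⟨z, hz, hFz⟩ := intermediate_value_Icc hab hF_cont hmem
      exact ⟨z, fun _ ↦ ⟨hz, hFz⟩⟩
    · exact ⟨0, fun h ↦ absurd h hk⟩
  choose x hx using hquantile
  have hh : 0 < δ / T := div_pos hδ hT0
  refine ⟨n, fun _ ↦ 1 / n, fun k ↦ x k, fun _ ↦ δ / T, fun _ ↦ by positivity, ?_, fun _ ↦ hh, ?_⟩
  · simp [hn'.ne']
  intro y hy
  have hF0 : 0 ≤ F y := hFa ▸ hF_mono.monotoneOn (Set.left_mem_Icc.mpr hab) hy hy.1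
  have hF1 : F y ≤ 1 := hFb ▸ hF_mono.monotoneOn hy (Set.right_mem_Icc.mpr hab) hy.2
  rw [sigmoid_eq_real_sigmoid,
    Fin.sum_univ_eq_sum_range (fun k ↦ 1 / (n : ℝ) * Real.sigmoid ((y - x k) / (δ / T))) n]
  have hTδ : T * (δ / T) = δ := mul_div_cancel₀ _ hT0.ne'
  have hlower := sub_le_average (g := fun k ↦ Real.sigmoid ((y - x k) / (δ / T)))
    (v := F y - ε / 4) (η := ε / 4) hn (by linarith) (by linarith)
    (fun k _ ↦ Real.sigmoid_nonneg _) (by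
      intro k hk hkv
      obtain ⟨hxk, hFk⟩ := hx k hk
      have hlt : x k < y := (hF_mono.lt_iff_lt hxk hy).mp (by linarith)
      have hdist : δ ≤ y - x k := by
        by_contra! hcon
        have h := hFδ y hy (x k) hxk (by rw [Real.dist_eq, abs_lt]; constructor <;> linarith)
        rw [Real.dist_eq, abs_lt] at h
        linarith
      refine hT.le.trans (Real.sigmoid_le ?_)
      rwa [le_div_iff₀ hh, hTδ])
  have hupper := average_le_add (g := fun k ↦ Real.sigmoid ((y - x k) / (δ / T)))
    (v := F y + ε / 4) (η := ε / 4) hn (by linarith) (by linarith)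
    (fun k _ ↦ Real.sigmoid_le_one _) (by
      intro k hk hkv
      obtain ⟨hxk, hFk⟩ := hx k hk
      have hlt : y < x k := (hF_mono.lt_iff_lt hy hxk).mp (by linarith)
      have hdist : δ ≤ x k - y := by
        by_contra! hcon
        have h := hFδ y hy (x k) hxk (by rw [Real.dist_eq, abs_lt]; constructor <;> linarith)
        rw [Real.dist_eq, abs_lt] at h
        linarith
      have hle : Real.sigmoid ((y - x k) / (δ / T)) ≤ Real.sigmoid (-T) := by
        refine Real.sigmoid_le ?_
        rw [div_le_iff₀ hh, neg_mul, hTδ]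
        linarith
      rw [Real.sigmoid_neg] at hle
      linarith)
  rw [abs_lt]
  constructor <;> linarith
end

section
/- Let ρ : ℝ → ℝ be a continuous, nonnegative, Lebesgue-integrable function with ∫_ℝ ρ = 1, and let F(x) = ∫_{−∞}^x ρ(t) dt. Let C be a nonempty finite set and v : C → ℝ. Then Σ_{j ∈ C} ∫_ℝ ρ(e) · ∏_{j' ∈ C, j' ≠ j} F(v(j) + e − v(j')) de = 1; that is, the choice probabilities defined by the integral formula sum to one over the choice set. -/
open MeasureTheory Filter Topology

theorem hasDerivAt_setIntegral_Iic {ρ : ℝ → ℝ} (hρ_cont : Continuous ρ) (hρ_int : Integrable ρ)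
    (x : ℝ) : HasDerivAt (fun y => ∫ t in Set.Iic y, ρ t) (ρ x) x := by
  have h : (fun y => ∫ t in Set.Iic y, ρ t) =
      fun y => (∫ t in Set.Iic (0 : ℝ), ρ t) + ∫ t in (0 : ℝ)..y, ρ t := by
    funext y
    rw [← intervalIntegral.integral_Iic_sub_Iic hρ_int.integrableOn hρ_int.integrableOn]
    ring
  rw [h]
  exact (hρ_cont.integral_hasStrictDerivAt 0 x).hasDerivAt.const_add _

/-- If `F` has integrable derivative `ρ`, is bounded by `1`, and tends to `0` at `-∞` and to `1` at
`∞`, then the terms of the product rule for `∏ j ∈ C, F (u - v j)` have integrals summing to `1`. -/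
theorem sum_integral_deriv_mul_prod_erase {ρ F : ℝ → ℝ} (hρ_int : Integrable ρ)
    (hderiv : ∀ x, HasDerivAt F (ρ x) x) (hF_le : ∀ x, ‖F x‖ ≤ 1)
    (hbot : Tendsto F atBot (𝓝 0)) (htop : Tendsto F atTop (𝓝 1))
    {α : Type*} [DecidableEq α] {C : Finset α} (hC : C.Nonempty) (v : α → ℝ) :
    ∑ j ∈ C, ∫ u : ℝ, ρ (u - v j) * ∏ j' ∈ C.erase j, F (u - v j') = 1 := by
  have hF_cont : Continuous F := continuous_iff_continuousAt.2 fun x => (hderiv x).continuousAt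
  have hint : ∀ j ∈ C, Integrable fun u => ρ (u - v j) * ∏ j' ∈ C.erase j, F (u - v j') := by
    intro j _
    refine (hρ_int.comp_sub_right (v j)).mul_bdd (c := 1)
      (Continuous.aestronglyMeasurable (by fun_prop)) (ae_of_all _ fun u => ?_)
    rw [norm_prod]
    exact Finset.prod_le_one (fun _ _ => norm_nonneg _) fun _ _ => hF_le _
  have hprod : ∀ u, HasDerivAt (fun u => ∏ j ∈ C, F (u - v j))
      (∑ j ∈ C, ρ (u - v j) * ∏ j' ∈ C.erase j, F (u - v j')) u := by
    intro u
    convert! HasDerivAt.fun_finsetProd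
      (fun j (_ : j ∈ C) => (hderiv (u - v j)).comp_sub_const u (v j)) using 2
    simp only [smul_eq_mul, mul_comm]
  have hprod_bot : Tendsto (fun u => ∏ j ∈ C, F (u - v j)) atBot (𝓝 0) := by
    have h := tendsto_finsetProd C fun j _ =>
      hbot.comp (tendsto_atBot_add_const_right atBot (-v j) tendsto_id)
    simpa [sub_eq_add_neg, Finset.prod_const, hC.card_pos.ne'] using h
  have hprod_top : Tendsto (fun u => ∏ j ∈ C, F (u - v j)) atTop (𝓝 1) := by
    have h := tendsto_finsetProd C fun j _ =>
      htop.comp (tendsto_atTop_add_const_right atTop (-v j) tendsto_id)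
    simpa [sub_eq_add_neg] using h
  rw [← integral_finsetSum C hint, integral_of_hasDerivAt_of_tendsto hprod
    (integrable_finsetSum C hint) hprod_bot hprod_top, sub_zero]

/-- The choice probabilities defined by the integral formula
`P j = ∫ ρ(e) · ∏_{j' ∈ C, j' ≠ j} F(v j + e − v j') de` sum to one over the
(nonempty, finite) choice set `C`, whenever `ρ` is a continuous probability
density with cdf `F`. -/
theorem choice_probabilities_sum_to_one
    (ρ : ℝ → ℝ) (hρ_cont : Continuous ρ) (hρ_nonneg : ∀ t, 0 ≤ ρ t)
    (hρ_int : Integrable ρ) (hρ_one : ∫ t : ℝ, ρ t = 1)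
    (F : ℝ → ℝ) (hF : ∀ y : ℝ, F y = ∫ t in Set.Iic y, ρ t)
    {α : Type*} [DecidableEq α] (C : Finset α) (hC : C.Nonempty) (v : α → ℝ) :
    ∑ j ∈ C, ∫ e : ℝ, ρ e * ∏ j' ∈ C.erase j, F (v j + e - v j') = 1 := by
  obtain rfl : F = fun y => ∫ t in Set.Iic y, ρ t := funext hF
  have hF_le : ∀ y, ‖∫ t in Set.Iic y, ρ t‖ ≤ 1 := by
    intro y
    rw [Real.norm_of_nonneg (integral_nonneg hρ_nonneg), ← hρ_one]
    exact setIntegral_le_integral hρ_int (ae_of_all _ hρ_nonneg)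
  have htop : Tendsto (fun y => ∫ t in Set.Iic y, ρ t) atTop (𝓝 1) := by
    rw [← hρ_one]
    exact (aecover_Iic tendsto_id).integral_tendsto_of_countably_generated hρ_int
  rw [← sum_integral_deriv_mul_prod_erase hρ_int (hasDerivAt_setIntegral_Iic hρ_cont hρ_int) hF_le
    (tendsto_integral_Iic_zero tendsto_id) htop hC v]
  refine Finset.sum_congr rfl fun j _ => ?_
  rw [← integral_add_left_eq_self (fun u => ρ (u - v j) * _) (v j)]
  simp only [add_sub_cancel_left]
end
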